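/- arXiv:2512.01482 — 6 statements merged into one kernel-verified Lean document; each statement's English description precedes it below -/
import Mathlib

section
/- Let Φ ∈ ℝ^10 with entries Φ = (m, h₁, h₂, h₃, I₁₁, I₂₂, I₃₃, I₁₂, I₂₃, I₁₃). Then Φ is physically consistent — i.e., there exists a function ρ : ℝ³ → ℝ with ρ(x) ≥ 0 for all x ∈ ℝ³ such that the functions x ↦ ρ(x), x ↦ ρ(x)·x and x ↦ ρ(x)·𝒮(x)ᵀ𝒮(x) are Lebesgue-integrable on ℝ³ with m = ∫ ρ(x) dx > 0, h = ∫ ρ(x)·x dx and I = ∫ ρ(x)·𝒮(x)ᵀ𝒮(x) dx — if and only if the 4×4 matrix f(Φ) is positive definite. -/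
noncomputable section

open Matrix MeasureTheory

/-- The skew-symmetric cross-product matrix `𝒮(x)` with `𝒮(x) y = x × y`. -/
def crossMat (x : Fin 3 → ℝ) : Matrix (Fin 3) (Fin 3) ℝ :=
  !![0, -x 2, x 1; x 2, 0, -x 0; -x 1, x 0, 0]

/-- The first moment of mass `h = (h₁,h₂,h₃)` from `Φ`. -/
def hVec (Φ : Fin 10 → ℝ) : Fin 3 → ℝ := ![Φ 1, Φ 2, Φ 3]

/-- The inertia matrix `I` from `Φ = (m,h₁,h₂,h₃,I₁₁,I₂₂,I₃₃,I₁₂,I₂₃,I₁₃)`. -/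
def Imat (Φ : Fin 10 → ℝ) : Matrix (Fin 3) (Fin 3) ℝ :=
  !![Φ 4, Φ 7, Φ 9; Φ 7, Φ 5, Φ 8; Φ 9, Φ 8, Φ 6]

/-- `Σ = (1/2)·tr(I)·I₃ − I`. -/
def SigmaMat (Φ : Fin 10 → ℝ) : Matrix (Fin 3) (Fin 3) ℝ :=
  ((1 / 2 : ℝ) * (Imat Φ).trace) • (1 : Matrix (Fin 3) (Fin 3) ℝ) - Imat Φ

/-- The 4×4 matrix `f(Φ) = [[Σ, h],[hᵀ, m]]`. -/
def fMat (Φ : Fin 10 → ℝ) : Matrix (Fin 3 ⊕ Fin 1) (Fin 3 ⊕ Fin 1) ℝ :=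
  Matrix.fromBlocks (SigmaMat Φ) (Matrix.of fun i _ => hVec Φ i)
    (Matrix.of fun _ j => hVec Φ j) (Matrix.of fun _ _ => Φ 0)

namespace ProbabilityTheory

lemma integrable_gaussianPDFReal_mul_pow (n : ℕ) :
    Integrable fun t : ℝ => gaussianPDFReal 0 1 t * t ^ n := by
  have h : Integrable (fun t : ℝ => t ^ n) (gaussianReal 0 1) :=
    integrable_pow_of_mem_interior_integrableExpSet (X := id) (by simp) n
  rw [gaussianReal_of_var_ne_zero 0 one_ne_zero,
    integrable_withDensity_iff_integrable_smul' (measurable_gaussianPDF 0 1)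
      (ae_of_all _ fun _ => gaussianPDF_lt_top)] at h
  simpa [toReal_gaussianPDF] using h

lemma integral_gaussianPDFReal_mul_self :
    ∫ t : ℝ, gaussianPDFReal 0 1 t * t = 0 := by
  simpa [integral_gaussianReal_eq_integral_smul one_ne_zero] using
    integral_id_gaussianReal (μ := 0) (v := 1)

lemma integral_gaussianPDFReal_mul_sq :
    ∫ t : ℝ, gaussianPDFReal 0 1 t * t ^ 2 = 1 := by
  have h := variance_of_integral_eq_zero (X := fun t : ℝ => t) (μ := gaussianReal 0 1)
    (by fun_prop) integral_id_gaussianReal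
  rw [variance_fun_id_gaussianReal, integral_gaussianReal_eq_integral_smul one_ne_zero] at h
  simpa using h.symm

variable {ι : Type*} [Fintype ι]

/-- The density of the standard Gaussian distribution on `ι → ℝ`. -/
def stdGaussianPi (y : ι → ℝ) : ℝ := ∏ i, gaussianPDFReal 0 1 (y i)

lemma stdGaussianPi_nonneg (y : ι → ℝ) : 0 ≤ stdGaussianPi y :=
  Finset.prod_nonneg fun _ _ => gaussianPDFReal_nonneg _ _ _

lemma integrable_stdGaussianPi_mul_monomial (p : ι → ℕ) :
    Integrable fun y : ι → ℝ => stdGaussianPi y * ∏ i, y i ^ p i := by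
  simp_rw [stdGaussianPi, ← Finset.prod_mul_distrib]
  exact Integrable.fintype_prod fun i => integrable_gaussianPDFReal_mul_pow (p i)

lemma integral_stdGaussianPi_mul_monomial (p : ι → ℕ) :
    ∫ y : ι → ℝ, stdGaussianPi y * ∏ i, y i ^ p i =
      ∏ i, ∫ t : ℝ, gaussianPDFReal 0 1 t * t ^ p i := by
  simp_rw [stdGaussianPi, ← Finset.prod_mul_distrib]
  exact integral_fintype_prod_volume_eq_prod fun i t => gaussianPDFReal 0 1 t * t ^ p i

lemma integrable_stdGaussianPi : Integrable (stdGaussianPi (ι := ι)) := by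
  simpa using integrable_stdGaussianPi_mul_monomial (0 : ι → ℕ)

lemma integral_stdGaussianPi : ∫ y : ι → ℝ, stdGaussianPi y = 1 := by
  simpa [integral_gaussianPDFReal_eq_one] using integral_stdGaussianPi_mul_monomial (0 : ι → ℕ)

variable [DecidableEq ι]

lemma prod_pow_single (y : ι → ℝ) (k : ι) : ∏ i, y i ^ (Pi.single k 1 : ι → ℕ) i = y k := by
  simp [Pi.single_apply, pow_ite]

lemma prod_pow_single_add_single (y : ι → ℝ) (k l : ι) :
    ∏ i, y i ^ (Pi.single k 1 + Pi.single l 1 : ι → ℕ) i = y k * y l := by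
  simp_rw [Pi.add_apply, pow_add, Finset.prod_mul_distrib, prod_pow_single]

lemma integrable_stdGaussianPi_mul_apply (k : ι) :
    Integrable fun y : ι → ℝ => stdGaussianPi y * y k := by
  simpa only [prod_pow_single] using integrable_stdGaussianPi_mul_monomial (Pi.single k 1)

lemma integral_stdGaussianPi_mul_apply (k : ι) :
    ∫ y : ι → ℝ, stdGaussianPi y * y k = 0 := by
  have h := integral_stdGaussianPi_mul_monomial (Pi.single k 1 : ι → ℕ)
  simp only [prod_pow_single] at h
  rw [h]
  exact Finset.prod_eq_zero (Finset.mem_univ k) (by simpa using integral_gaussianPDFReal_mul_self)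

lemma integrable_stdGaussianPi_mul_apply_mul_apply (k l : ι) :
    Integrable fun y : ι → ℝ => stdGaussianPi y * (y k * y l) := by
  refine (integrable_stdGaussianPi_mul_monomial (Pi.single k 1 + Pi.single l 1)).congr
    (ae_of_all _ fun y => ?_)
  simp only [prod_pow_single_add_single]

lemma integral_stdGaussianPi_mul_apply_mul_apply (k l : ι) :
    ∫ y : ι → ℝ, stdGaussianPi y * (y k * y l) = (1 : Matrix ι ι ℝ) k l := by
  have h := integral_stdGaussianPi_mul_monomial (Pi.single k 1 + Pi.single l 1 : ι → ℕ)
  simp only [prod_pow_single_add_single] at h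
  rw [h]
  obtain rfl | hkl := eq_or_ne k l
  · rw [one_apply_eq]
    refine Finset.prod_eq_one fun i _ => ?_
    obtain rfl | hi := eq_or_ne i k
    · simpa using integral_gaussianPDFReal_mul_sq
    · simpa [hi] using integral_gaussianPDFReal_eq_one 0 one_ne_zero
  · rw [one_apply_ne hkl]
    exact Finset.prod_eq_zero (Finset.mem_univ k)
      (by simpa [hkl] using integral_gaussianPDFReal_mul_self)

end ProbabilityTheory

section AffineChange

open ProbabilityTheory

variable {ι : Type*} [Fintype ι] [DecidableEq ι] {A : Matrix ι ι ℝ}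

lemma map_mulVec_add_volume (hA : A.det ≠ 0) (c : ι → ℝ) :
    Measure.map (fun y => A *ᵥ y + c) volume =
      ENNReal.ofReal |A.det⁻¹| • (volume : Measure (ι → ℝ)) := by
  have h := Real.map_matrix_volume_pi_eq_smul_volume_pi hA
  have hc := (measurePreserving_add_right (volume : Measure (ι → ℝ)) c).map_eq
  conv_rhs => rw [← hc, ← Measure.map_smul, ← h]
  rw [Measure.map_map (by fun_prop) (LinearMap.continuous_of_finiteDimensional _).measurable]
  rfl

lemma measurableEmbedding_mulVec_add (hA : A.det ≠ 0) (c : ι → ℝ) :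
    MeasurableEmbedding fun y => A *ᵥ y + c :=
  Continuous.measurableEmbedding (by fun_prop) <| (add_left_injective c).comp <|
    mulVec_injective_of_isUnit <| (isUnit_iff_isUnit_det A).2 hA.isUnit

/-- The density of the image of the standard Gaussian distribution under `y ↦ A y + c`. -/
def affineGaussianPi (A : Matrix ι ι ℝ) (c x : ι → ℝ) : ℝ :=
  |A.det|⁻¹ * stdGaussianPi (A⁻¹ *ᵥ (x - c))

lemma affineGaussianPi_nonneg (A : Matrix ι ι ℝ) (c x : ι → ℝ) : 0 ≤ affineGaussianPi A c x :=
  mul_nonneg (by positivity) (stdGaussianPi_nonneg _)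

lemma affineGaussianPi_mulVec_add (hA : A.det ≠ 0) (c y : ι → ℝ) :
    affineGaussianPi A c (A *ᵥ y + c) = |A.det|⁻¹ * stdGaussianPi y := by
  simp [affineGaussianPi, nonsing_inv_mul A hA.isUnit]

lemma integrable_affineGaussianPi_mul (hA : A.det ≠ 0) (c : ι → ℝ) {P : (ι → ℝ) → ℝ}
    (h : Integrable fun y => stdGaussianPi y * P (A *ᵥ y + c)) :
    Integrable fun x => affineGaussianPi A c x * P x := by
  rw [← integrable_smul_measure (c := ENNReal.ofReal |A.det⁻¹|) (by simpa using hA)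
    ENNReal.ofReal_ne_top, ← map_mulVec_add_volume hA c,
    (measurableEmbedding_mulVec_add hA c).integrable_map_iff]
  simpa [Function.comp_def, affineGaussianPi_mulVec_add hA, mul_assoc] using h.const_mul |A.det|⁻¹

lemma integral_affineGaussianPi_mul (hA : A.det ≠ 0) (c : ι → ℝ) (P : (ι → ℝ) → ℝ) :
    ∫ x, affineGaussianPi A c x * P x = ∫ y, stdGaussianPi y * P (A *ᵥ y + c) := by
  have h := (measurableEmbedding_mulVec_add hA c).integral_map (μ := volume)
    fun x => affineGaussianPi A c x * P x
  rw [map_mulVec_add_volume hA, integral_smul_measure] at h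
  simp_rw [affineGaussianPi_mulVec_add hA, mul_assoc, integral_const_mul] at h
  rw [ENNReal.toReal_ofReal (abs_nonneg _), abs_inv, smul_eq_mul] at h
  exact mul_left_cancel₀ (inv_ne_zero (abs_ne_zero.2 hA)) h

lemma integrable_affineGaussianPi (hA : A.det ≠ 0) (c : ι → ℝ) :
    Integrable (affineGaussianPi A c) := by
  simpa using integrable_affineGaussianPi_mul hA c (P := fun _ => 1)
    (by simpa using integrable_stdGaussianPi)

lemma integral_affineGaussianPi (hA : A.det ≠ 0) (c : ι → ℝ) :
    ∫ x, affineGaussianPi A c x = 1 := by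
  simpa [integral_stdGaussianPi] using integral_affineGaussianPi_mul hA c fun _ => 1

lemma hasFirstMoment_affineGaussianPi (hA : A.det ≠ 0) (c : ι → ℝ) (i : ι) :
    (Integrable fun x => affineGaussianPi A c x * x i) ∧
      ∫ x, affineGaussianPi A c x * x i = c i := by
  have e : (fun y : ι → ℝ => stdGaussianPi y * (A *ᵥ y + c) i) = fun y =>
      ∑ k, A i k * (stdGaussianPi y * y k) + c i * stdGaussianPi y := by
    ext y
    simp only [Pi.add_apply, mulVec, dotProduct, mul_add, Finset.mul_sum]
    congr 1
    · exact Finset.sum_congr rfl fun k _ => by ring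
    · ring
  have hs : ∀ k ∈ Finset.univ, Integrable fun y : ι → ℝ => A i k * (stdGaussianPi y * y k) :=
    fun k _ => (integrable_stdGaussianPi_mul_apply k).const_mul _
  have hc := (integrable_stdGaussianPi (ι := ι)).const_mul (c i)
  refine ⟨integrable_affineGaussianPi_mul hA c (P := fun x => x i)
    (e ▸ (integrable_finsetSum _ hs).add hc), ?_⟩
  rw [integral_affineGaussianPi_mul hA c fun x => x i, e,
    integral_add (integrable_finsetSum _ hs) hc, integral_finsetSum _ hs]
  simp [integral_const_mul, integral_stdGaussianPi_mul_apply, integral_stdGaussianPi]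

lemma hasSecondMoment_affineGaussianPi (hA : A.det ≠ 0) (c : ι → ℝ) (i j : ι) :
    (Integrable fun x => affineGaussianPi A c x * (x i * x j)) ∧
      ∫ x, affineGaussianPi A c x * (x i * x j) = (A * Aᵀ) i j + c i * c j := by
  have e : (fun y : ι → ℝ => stdGaussianPi y * ((A *ᵥ y + c) i * (A *ᵥ y + c) j)) = fun y =>
      ∑ k, ∑ l, A i k * A j l * (stdGaussianPi y * (y k * y l)) +
        (∑ k, (A i k * c j + A j k * c i) * (stdGaussianPi y * y k) +
        c i * c j * stdGaussianPi y) := by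
    ext y
    have h₁ : (A *ᵥ y + c) i * (A *ᵥ y + c) j = (∑ k, A i k * y k) * (∑ l, A j l * y l) +
        ((∑ k, A i k * y k) * c j + (∑ k, A j k * y k) * c i + c i * c j) := by
      simp only [Pi.add_apply, mulVec, dotProduct]
      ring
    rw [h₁, Finset.sum_mul_sum, Finset.sum_mul, Finset.sum_mul, ← Finset.sum_add_distrib, mul_add,
      mul_add, Finset.mul_sum, Finset.mul_sum]
    simp_rw [Finset.mul_sum]
    refine congr_arg₂ _ ?_ (congr_arg₂ _ ?_ (by ring))
    · exact Finset.sum_congr rfl fun k _ => Finset.sum_congr rfl fun l _ => by ring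
    · exact Finset.sum_congr rfl fun k _ => by ring
  have hl : ∀ k, ∀ l ∈ Finset.univ,
      Integrable fun y : ι → ℝ => A i k * A j l * (stdGaussianPi y * (y k * y l)) :=
    fun k l _ => (integrable_stdGaussianPi_mul_apply_mul_apply k l).const_mul _
  have hkl := fun k (_ : k ∈ Finset.univ) => integrable_finsetSum _ (hl k)
  have hk : ∀ k ∈ Finset.univ,
      Integrable fun y : ι → ℝ => (A i k * c j + A j k * c i) * (stdGaussianPi y * y k) :=
    fun k _ => (integrable_stdGaussianPi_mul_apply k).const_mul _
  have hc := (integrable_stdGaussianPi (ι := ι)).const_mul (c i * c j)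
  have hkc : Integrable fun y : ι → ℝ => ∑ k, (A i k * c j + A j k * c i) *
      (stdGaussianPi y * y k) + c i * c j * stdGaussianPi y :=
    (integrable_finsetSum _ hk).add hc
  refine ⟨integrable_affineGaussianPi_mul hA c (P := fun x => x i * x j)
    (e ▸ (integrable_finsetSum _ hkl).add hkc), ?_⟩
  rw [integral_affineGaussianPi_mul hA c fun x => x i * x j, e,
    integral_add (integrable_finsetSum _ hkl) hkc,
    integral_add (integrable_finsetSum _ hk) hc, integral_finsetSum _ hkl,
    integral_finsetSum _ hk]
  simp_rw [fun k => integral_finsetSum _ (hl k), integral_const_mul,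
    integral_stdGaussianPi_mul_apply, integral_stdGaussianPi_mul_apply_mul_apply,
    integral_stdGaussianPi]
  simp [Matrix.mul_apply, one_apply]

end AffineChange

/-- The set where a nonzero affine function vanishes is Lebesgue-null. -/
lemma volume_dotProduct_add_eq_zero {ι : Type*} [Fintype ι] {a : ι → ℝ} {b : ℝ}
    (h : a ≠ 0 ∨ b ≠ 0) : volume {x : ι → ℝ | a ⬝ᵥ x + b = 0} = 0 := by
  let L : (ι → ℝ) →ᵃ[ℝ] ℝ := (dotProductBilin ℝ ℝ a).toAffineMap + AffineMap.const ℝ _ b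
  have hL : ∀ x, L x = a ⬝ᵥ x + b := fun x => rfl
  let s : AffineSubspace ℝ (ι → ℝ) := (AffineSubspace.mk' (0 : ℝ) ⊥).comap L
  have hmem : ∀ x, x ∈ s ↔ a ⬝ᵥ x + b = 0 := fun x => by
    simp [s, AffineSubspace.mem_comap, AffineSubspace.mem_mk', hL]
  have hs : s ≠ ⊤ := by
    intro ht
    have hall : ∀ x, a ⬝ᵥ x + b = 0 := fun x => (hmem x).1 (ht ▸ AffineSubspace.mem_top ℝ _ x)
    have hb : b = 0 := by simpa using hall 0
    have ha : a = 0 := dotProduct_self_eq_zero.1 (by simpa [hb] using hall a)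
    exact h.elim (· ha) (· hb)
  have hset : {x : ι → ℝ | a ⬝ᵥ x + b = 0} = s := Set.ext fun x => (hmem x).symm
  rw [hset]
  exact Measure.addHaar_affineSubspace volume s hs

lemma crossMat_transpose_mul_self_apply (x : Fin 3 → ℝ) (i j : Fin 3) :
    ((crossMat x)ᵀ * crossMat x) i j =
      (∑ k, x k * x k) * (1 : Matrix (Fin 3) (Fin 3) ℝ) i j - x i * x j := by
  fin_cases i <;> fin_cases j <;>
    simp [crossMat, Matrix.mul_apply, Fin.sum_univ_three] <;> ring

lemma apply_mul_apply_eq_crossMat (x : Fin 3 → ℝ) (i j : Fin 3) :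
    x i * x j = 1 / 2 * (∑ k, ((crossMat x)ᵀ * crossMat x) k k) *
      (1 : Matrix (Fin 3) (Fin 3) ℝ) i j - ((crossMat x)ᵀ * crossMat x) i j := by
  simp only [crossMat_transpose_mul_self_apply, Fin.sum_univ_three, one_apply_eq]
  ring

lemma Imat_eq (Φ : Fin 10 → ℝ) (i j : Fin 3) :
    Imat Φ i j = (∑ k, SigmaMat Φ k k) * (1 : Matrix (Fin 3) (Fin 3) ℝ) i j - SigmaMat Φ i j := by
  simp only [SigmaMat, trace, Fin.sum_univ_three, Matrix.sub_apply, Matrix.smul_apply, smul_eq_mul,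
    one_apply_eq, diag_apply]
  ring

lemma Imat_isSymm (Φ : Fin 10 → ℝ) : (Imat Φ).IsSymm := by
  ext i j
  fin_cases i <;> fin_cases j <;> rfl

lemma SigmaMat_isSymm (Φ : Fin 10 → ℝ) : (SigmaMat Φ).IsSymm :=
  ((isSymm_one).smul _).sub (Imat_isSymm Φ)

lemma fMat_isHermitian (Φ : Fin 10 → ℝ) : (fMat Φ).IsHermitian := by
  rw [IsHermitian, conjTranspose_eq_transpose_of_trivial]
  exact (SigmaMat_isSymm Φ).fromBlocks rfl rfl

lemma dotProduct_fMat_mulVec (Φ : Fin 10 → ℝ) (v : Fin 3 ⊕ Fin 1 → ℝ) :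
    v ⬝ᵥ (fMat Φ *ᵥ v) =
      ∑ i, ∑ j, v (.inl i) * v (.inl j) * SigmaMat Φ i j +
        (2 * v (.inr 0) * ∑ i, v (.inl i) * hVec Φ i + v (.inr 0) ^ 2 * Φ 0) := by
  simp [fMat, dotProduct, mulVec, Fin.sum_univ_three]
  ring

/-- The integral of `ρ` times the square of an affine function in terms of the moments of `ρ`. -/
lemma integral_mul_dotProduct_add_sq {ι : Type*} [Fintype ι] {ρ : (ι → ℝ) → ℝ}
    (h₀ : Integrable ρ) (h₁ : ∀ i, Integrable fun x => ρ x * x i)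
    (h₂ : ∀ i j, Integrable fun x => ρ x * (x i * x j)) (a : ι → ℝ) (b : ℝ) :
    (Integrable fun x => ρ x * (a ⬝ᵥ x + b) ^ 2) ∧
      ∫ x, ρ x * (a ⬝ᵥ x + b) ^ 2 = (∑ i, ∑ j, a i * a j * ∫ x, ρ x * (x i * x j)) +
        (2 * b * (∑ i, a i * ∫ x, ρ x * x i) + b ^ 2 * ∫ x, ρ x) := by
  have e : (fun x => ρ x * (a ⬝ᵥ x + b) ^ 2) = fun x =>
      ∑ i, ∑ j, a i * a j * (ρ x * (x i * x j)) +
        (2 * b * ∑ i, a i * (ρ x * x i) + b ^ 2 * ρ x) := by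
    ext x
    have hs : ∑ i, ∑ j, a i * a j * (ρ x * (x i * x j)) = ρ x * ((a ⬝ᵥ x) * (a ⬝ᵥ x)) := by
      simp_rw [dotProduct, Finset.sum_mul_sum, Finset.mul_sum]
      exact Finset.sum_congr rfl fun i _ => Finset.sum_congr rfl fun j _ => by ring
    have hl : ∑ i, a i * (ρ x * x i) = ρ x * (a ⬝ᵥ x) := by
      simp_rw [dotProduct, Finset.mul_sum]
      exact Finset.sum_congr rfl fun i _ => by ring
    rw [hs, hl]
    ring
  have hj : ∀ i, ∀ j ∈ Finset.univ, Integrable fun x => a i * a j * (ρ x * (x i * x j)) :=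
    fun i j _ => (h₂ i j).const_mul _
  have hij := fun i (_ : i ∈ Finset.univ) => integrable_finsetSum _ (hj i)
  have hi : ∀ i ∈ Finset.univ, Integrable fun x => a i * (ρ x * x i) :=
    fun i _ => (h₁ i).const_mul _
  have hb := (integrable_finsetSum _ hi).const_mul (2 * b)
  have hc : Integrable fun x => 2 * b * ∑ i, a i * (ρ x * x i) + b ^ 2 * ρ x :=
    hb.add (h₀.const_mul _)
  refine ⟨e ▸ (integrable_finsetSum _ hij).add hc, ?_⟩
  rw [e, integral_add (integrable_finsetSum _ hij) hc, integral_add hb (h₀.const_mul _),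
    integral_finsetSum _ hij, integral_const_mul, integral_finsetSum _ hi, integral_const_mul]
  simp_rw [fun i => integral_finsetSum _ (hj i), integral_const_mul]

/-- A nonnegative density that is not almost everywhere zero has a positive integral against the
square of any nonzero affine function. -/
lemma integral_mul_dotProduct_add_sq_pos {ι : Type*} [Fintype ι] {ρ : (ι → ℝ) → ℝ}
    (hρ : ∀ x, 0 ≤ ρ x) (hpos : 0 < ∫ x, ρ x) {a : ι → ℝ} {b : ℝ} (hab : a ≠ 0 ∨ b ≠ 0)
    (hint : Integrable fun x => ρ x * (a ⬝ᵥ x + b) ^ 2) :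
    0 < ∫ x, ρ x * (a ⬝ᵥ x + b) ^ 2 := by
  have hnn : ∀ x, 0 ≤ ρ x * (a ⬝ᵥ x + b) ^ 2 := fun x => mul_nonneg (hρ x) (sq_nonneg _)
  refine (integral_nonneg hnn).lt_of_ne' fun h => hpos.ne' ?_
  rw [integral_eq_zero_iff_of_nonneg hnn hint] at h
  refine integral_eq_zero_of_ae ?_
  have hne : ∀ᵐ x : ι → ℝ, a ⬝ᵥ x + b ≠ 0 := by
    simpa [ae_iff] using volume_dotProduct_add_eq_zero hab
  filter_upwards [h, hne] with x hx hx'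
  exact (mul_eq_zero.1 hx).resolve_right (pow_ne_zero 2 hx')

lemma secondMoment_eq_SigmaMat {Φ : Fin 10 → ℝ} {ρ : (Fin 3 → ℝ) → ℝ}
    (hint : ∀ i j, Integrable fun x => ρ x * ((crossMat x)ᵀ * crossMat x) i j)
    (hI : ∀ i j, Imat Φ i j = ∫ x, ρ x * ((crossMat x)ᵀ * crossMat x) i j) (i j : Fin 3) :
    (Integrable fun x => ρ x * (x i * x j)) ∧ ∫ x, ρ x * (x i * x j) = SigmaMat Φ i j := by
  have e : (fun x => ρ x * (x i * x j)) = fun x =>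
      1 / 2 * (1 : Matrix (Fin 3) (Fin 3) ℝ) i j *
        (∑ k, ρ x * ((crossMat x)ᵀ * crossMat x) k k) -
      ρ x * ((crossMat x)ᵀ * crossMat x) i j := by
    ext x
    rw [apply_mul_apply_eq_crossMat, ← Finset.mul_sum]
    ring
  have hk := integrable_finsetSum Finset.univ fun k _ => hint k k
  refine ⟨e ▸ (hk.const_mul _).sub (hint i j), ?_⟩
  rw [e, integral_sub (hk.const_mul _) (hint i j), integral_const_mul,
    integral_finsetSum _ fun k _ => hint k k, ← hI]
  simp_rw [← hI]
  simp only [SigmaMat, trace, Matrix.sub_apply, Matrix.smul_apply, smul_eq_mul, diag_apply]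
  ring

lemma inertia_eq_Imat {Φ : Fin 10 → ℝ} {ρ : (Fin 3 → ℝ) → ℝ}
    (hint : ∀ i j, Integrable fun x => ρ x * (x i * x j))
    (hS : ∀ i j, ∫ x, ρ x * (x i * x j) = SigmaMat Φ i j) (i j : Fin 3) :
    (Integrable fun x => ρ x * ((crossMat x)ᵀ * crossMat x) i j) ∧
      Imat Φ i j = ∫ x, ρ x * ((crossMat x)ᵀ * crossMat x) i j := by
  have e : (fun x => ρ x * ((crossMat x)ᵀ * crossMat x) i j) = fun x =>
      (1 : Matrix (Fin 3) (Fin 3) ℝ) i j * (∑ k, ρ x * (x k * x k)) - ρ x * (x i * x j) := by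
    ext x
    rw [crossMat_transpose_mul_self_apply, ← Finset.mul_sum]
    ring
  have hk := integrable_finsetSum Finset.univ fun k _ => hint k k
  refine ⟨e ▸ (hk.const_mul _).sub (hint i j), ?_⟩
  rw [e, integral_sub (hk.const_mul _) (hint i j), integral_const_mul,
    integral_finsetSum _ fun k _ => hint k k, hS, Imat_eq]
  simp_rw [hS]
  ring

open scoped MatrixOrder in
lemma Matrix.PosDef.exists_eq_mul_transpose {ι : Type*} [Fintype ι] [DecidableEq ι]
    {S : Matrix ι ι ℝ} (hS : S.PosDef) : ∃ A : Matrix ι ι ℝ, A.det ≠ 0 ∧ A * Aᵀ = S := by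
  obtain ⟨B, rfl⟩ := CStarAlgebra.nonneg_iff_eq_star_mul_self.mp hS.posSemidef.nonneg
  have hB : (star B * B).det ≠ 0 := hS.det_pos.ne'
  rw [det_mul] at hB
  refine ⟨Bᵀ, ?_, ?_⟩
  · simpa using right_ne_zero_of_mul hB
  · simp [star_eq_conjTranspose, conjTranspose_eq_transpose_of_trivial]

lemma fMat_posDef_mass_pos {Φ : Fin 10 → ℝ} (h : (fMat Φ).PosDef) : 0 < Φ 0 := by
  simpa [fMat] using h.diag_pos (i := .inr 0)

/-- If `f(Φ)` is positive definite, so is the covariance matrix `Σ / m - c cᵀ`, `c = h / m`. -/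
lemma fMat_posDef_covariance {Φ : Fin 10 → ℝ} (h : (fMat Φ).PosDef) :
    ((Φ 0)⁻¹ • SigmaMat Φ - vecMulVec ((Φ 0)⁻¹ • hVec Φ) ((Φ 0)⁻¹ • hVec Φ)).PosDef := by
  have hm := fMat_posDef_mass_pos h
  refine .of_dotProduct_mulVec_pos ?_ fun a ha => ?_
  · rw [IsHermitian, conjTranspose_eq_transpose_of_trivial, transpose_sub, transpose_smul,
      (SigmaMat_isSymm Φ).eq, transpose_vecMulVec]
  · let v : Fin 3 ⊕ Fin 1 → ℝ := Sum.elim a fun _ => -(Φ 0)⁻¹ * ∑ i, a i * hVec Φ i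
    have hv : v ≠ 0 := fun hv => ha <| funext fun i => congr_fun hv (.inl i)
    have hpos := h.dotProduct_mulVec_pos hv
    rw [star_trivial, dotProduct_fMat_mulVec] at hpos
    convert! mul_pos (inv_pos.2 hm) hpos using 1
    simp [v, dotProduct, mulVec, Fin.sum_univ_three, vecMulVec_apply]
    field_simp
    ring

/-- `Φ` is physically consistent iff `f(Φ)` is positive definite. -/
theorem physicallyConsistent_iff_fMat_posDef (Φ : Fin 10 → ℝ) :
    (∃ ρ : (Fin 3 → ℝ) → ℝ,
        (∀ x, 0 ≤ ρ x) ∧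
        Integrable ρ ∧
        Integrable (fun x => ρ x • x) ∧
        (∀ i j, Integrable fun x => ρ x * ((crossMat x)ᵀ * crossMat x) i j) ∧
        Φ 0 = ∫ x, ρ x ∧ 0 < Φ 0 ∧
        hVec Φ = ∫ x, ρ x • x ∧
        (∀ i j, Imat Φ i j = ∫ x, ρ x * ((crossMat x)ᵀ * crossMat x) i j)) ↔
      (fMat Φ).PosDef := by
  constructor
  · rintro ⟨ρ, hρ, h₀, h₁, hint, hm, hpos, hh, hI⟩
    have h₂ := secondMoment_eq_SigmaMat hint hI
    have hc : ∀ i, Integrable fun x => ρ x * x i := fun i => h₁.eval i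
    have hh' : ∀ i, ∫ x, ρ x * x i = hVec Φ i := fun i => by
      rw [hh, eval_integral fun j => h₁.eval j]
      rfl
    refine .of_dotProduct_mulVec_pos (fMat_isHermitian Φ) fun v hv => ?_
    obtain ⟨hvint, hveq⟩ := integral_mul_dotProduct_add_sq h₀ hc (fun i j => (h₂ i j).1)
      (fun i => v (.inl i)) (v (.inr 0))
    simp_rw [fun i j => (h₂ i j).2, hh', ← hm] at hveq
    rw [star_trivial, dotProduct_fMat_mulVec, ← hveq]
    refine integral_mul_dotProduct_add_sq_pos hρ (hm ▸ hpos) ?_ hvint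
    contrapose! hv
    ext (i | i)
    · exact congr_fun hv.1 i
    · rw [Subsingleton.elim i 0]
      exact hv.2
  · intro h
    have hm := fMat_posDef_mass_pos h
    obtain ⟨A, hA, hAS⟩ := (fMat_posDef_covariance h).exists_eq_mul_transpose
    set c := (Φ 0)⁻¹ • hVec Φ with hc
    have h₁ := hasFirstMoment_affineGaussianPi hA c
    have h₂ := hasSecondMoment_affineGaussianPi hA c
    have hI := inertia_eq_Imat (Φ := Φ) (ρ := fun x => Φ 0 * affineGaussianPi A c x)
      (fun i j => by simpa only [mul_assoc] using (h₂ i j).1.const_mul (Φ 0)) fun i j => by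
        simp_rw [mul_assoc, integral_const_mul, (h₂ i j).2, hAS]
        simp [vecMulVec_apply, hm.ne']
    have hx : Integrable fun x => (Φ 0 * affineGaussianPi A c x) • x :=
      Integrable.of_eval fun i => by
        simpa only [mul_assoc, Pi.smul_apply, smul_eq_mul] using (h₁ i).1.const_mul (Φ 0)
    refine ⟨fun x => Φ 0 * affineGaussianPi A c x,
      fun x => mul_nonneg hm.le (affineGaussianPi_nonneg A c x),
      (integrable_affineGaussianPi hA c).const_mul _, hx, fun i j => (hI i j).1,
      by simp [integral_const_mul, integral_affineGaussianPi hA], hm, ?_, fun i j => (hI i j).2⟩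
    ext i
    rw [eval_integral fun j => hx.eval j]
    simp_rw [Pi.smul_apply, smul_eq_mul, mul_assoc, integral_const_mul, (h₁ i).2]
    simp [hc, hm.ne']

end
end

section
/- Let Φ ∈ ℝ^10 and let ξ > 0. If f(Φ) − ξ·I₄ is positive definite, then Z(Φ) − ξ·I₆ is positive definite; in particular the smallest eigenvalue of Z(Φ) is at least ξ. -/
noncomputable section

open Matrix

/-- The 6×6 matrix `Z(Φ) = [[m·I₃, −𝒮(h)],[−𝒮(h)ᵀ, I]]`. -/
def ZMat (Φ : Fin 10 → ℝ) : Matrix (Fin 3 ⊕ Fin 3) (Fin 3 ⊕ Fin 3) ℝ :=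
  Matrix.fromBlocks (Φ 0 • (1 : Matrix (Fin 3) (Fin 3) ℝ)) (-(crossMat (hVec Φ)))
    (-(crossMat (hVec Φ))ᵀ) (Imat Φ)

/-- The vector `a` with `a ⬝ᵥ (x, 1) = (u + w × x) k` for all `x`, where `v = (u, w)`. -/
def velocityCoeff (v : Fin 3 ⊕ Fin 3 → ℝ) (k : Fin 3) : Fin 3 ⊕ Fin 1 → ℝ :=
  Sum.elim (crossMat (fun i => v (Sum.inr i)) k) (fun _ => v (Sum.inl k))

/-- The quadratic form of `Z(Φ) - ξ` as a sum of values of the form of `f(Φ) - ξ`, plus a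
nonnegative remainder when `0 ≤ ξ`. -/
theorem dotProduct_ZMat_sub_smul_one_mulVec (Φ : Fin 10 → ℝ) (ξ : ℝ) (v : Fin 3 ⊕ Fin 3 → ℝ) :
    v ⬝ᵥ ((ZMat Φ - ξ • (1 : Matrix (Fin 3 ⊕ Fin 3) (Fin 3 ⊕ Fin 3) ℝ)) *ᵥ v) =
      ∑ k, velocityCoeff v k ⬝ᵥ
        ((fMat Φ - ξ • (1 : Matrix (Fin 3 ⊕ Fin 1) (Fin 3 ⊕ Fin 1) ℝ)) *ᵥ velocityCoeff v k) +
      ξ * ∑ i, v (Sum.inr i) ^ 2 := by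
  simp [velocityCoeff, ZMat, fMat, SigmaMat, Imat, hVec, crossMat, dotProduct, mulVec,
    Fintype.sum_sum_type, Fin.sum_univ_three, Matrix.trace, Matrix.one_apply]
  ring

theorem isHermitian_ZMat (Φ : Fin 10 → ℝ) : (ZMat Φ).IsHermitian := by
  refine IsHermitian.fromBlocks ?_ ?_ ?_
  · simp [IsHermitian]
  · simp [conjTranspose_eq_transpose_of_trivial]
  · ext i j
    fin_cases i <;> fin_cases j <;> simp [Imat]

/-- If `f(Φ) − ξ·I₄ ≻ 0` then `Z(Φ) − ξ·I₆ ≻ 0`; in particular every eigenvalue of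
`Z(Φ)` is at least `ξ`. -/
theorem ZMat_sub_smul_one_posDef_of_fMat (Φ : Fin 10 → ℝ) (ξ : ℝ) (hξ : 0 < ξ)
    (hf : (fMat Φ - ξ • (1 : Matrix (Fin 3 ⊕ Fin 1) (Fin 3 ⊕ Fin 1) ℝ)).PosDef) :
    (ZMat Φ - ξ • (1 : Matrix (Fin 3 ⊕ Fin 3) (Fin 3 ⊕ Fin 3) ℝ)).PosDef ∧
      ∀ (hZ : (ZMat Φ).IsHermitian) (i : Fin 3 ⊕ Fin 3), ξ ≤ hZ.eigenvalues i := by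
  have hpos : (ZMat Φ - ξ • (1 : Matrix (Fin 3 ⊕ Fin 3) (Fin 3 ⊕ Fin 3) ℝ)).PosDef := by
    refine PosDef.of_dotProduct_mulVec_pos
      ((isHermitian_ZMat Φ).sub (by simp [IsHermitian])) fun v hv => ?_
    rw [star_trivial, dotProduct_ZMat_sub_smul_one_mulVec]
    have hnonneg : ∀ k, 0 ≤ velocityCoeff v k ⬝ᵥ
        ((fMat Φ - ξ • (1 : Matrix (Fin 3 ⊕ Fin 1) (Fin 3 ⊕ Fin 1) ℝ)) *ᵥ velocityCoeff v k) :=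
      fun k => by simpa using hf.posSemidef.dotProduct_mulVec_nonneg (velocityCoeff v k)
    obtain ⟨k | i, hki⟩ := Function.ne_iff.mp hv
    · refine add_pos_of_pos_of_nonneg
        (Finset.sum_pos' (fun k _ => hnonneg k) ⟨k, Finset.mem_univ k, ?_⟩) (by positivity)
      have hne : velocityCoeff v k ≠ 0 := fun h => hki (congrFun h (Sum.inr 0))
      simpa using hf.dotProduct_mulVec_pos hne
    · refine add_pos_of_nonneg_of_pos (Finset.sum_nonneg fun k _ => hnonneg k) (mul_pos hξ ?_)
      exact Finset.sum_pos' (fun j _ => sq_nonneg _) ⟨i, Finset.mem_univ i, sq_pos_of_ne_zero hki⟩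
  refine ⟨hpos, fun hZ i => ?_⟩
  have hnorm : hZ.eigenvectorBasis i ⬝ᵥ hZ.eigenvectorBasis i = 1 := by
    simpa [inner, dotProduct] using hZ.eigenvectorBasis.inner_eq_one i
  have h := hpos.posSemidef.dotProduct_mulVec_nonneg (hZ.eigenvectorBasis i)
  rw [star_trivial, sub_mulVec, hZ.mulVec_eigenvectorBasis, smul_mulVec, one_mulVec,
    dotProduct_sub, dotProduct_smul, dotProduct_smul, hnorm] at h
  simpa using h

end
end

section
/- Let n, N ≥ 1 and J : ℝⁿ → ℝ^{(6N)×n}. The following are equivalent: (i) the Jacobian J is uniformly upper bounded, i.e., there exists δ ≥ 0 such that δ·I_n − J(q)ᵀJ(q) is positive semidefinite for all q ∈ ℝⁿ; (ii) for every constant Θ = (Φ₁,…,Φ_N) ∈ ℝ^{10N} such that f(Φ_l) is positive definite for every l ∈ {1,…,N}, there exists C ≥ 0 such that C·I_n − M(q,Θ) is positive semidefinite for all q ∈ ℝⁿ. -/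
noncomputable section

open Matrix

/-- `𝒵(Θ) = blockdiag(Z(Φ₁),…,Z(Φ_N))`. -/
def calZ {N : ℕ} (Θ : Fin N → Fin 10 → ℝ) :
    Matrix ((Fin 3 ⊕ Fin 3) × Fin N) ((Fin 3 ⊕ Fin 3) × Fin N) ℝ :=
  Matrix.blockDiagonal fun l => ZMat (Θ l)

/-- The mass matrix `M(q,Θ) = J(q)ᵀ 𝒵(Θ) J(q)`. -/
def massMatrix {n N : ℕ}
    (J : (Fin n → ℝ) → Matrix ((Fin 3 ⊕ Fin 3) × Fin N) (Fin n) ℝ)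
    (Θ : Fin N → Fin 10 → ℝ) (q : Fin n → ℝ) : Matrix (Fin n) (Fin n) ℝ :=
  (J q)ᵀ * calZ Θ * J q

/-- A real symmetric matrix is bounded above, in the Loewner order, by a multiple of the identity. -/
theorem exists_smul_one_sub_posSemidef {ι : Type*} [Fintype ι] [DecidableEq ι]
    {A : Matrix ι ι ℝ} (hA : A.IsHermitian) :
    ∃ c : ℝ, 0 ≤ c ∧ (c • (1 : Matrix ι ι ℝ) - A).PosSemidef := by
  refine ⟨∑ i, ∑ j, |A i j|, Finset.sum_nonneg fun i _ => Finset.sum_nonneg fun j _ =>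
    abs_nonneg _, .of_dotProduct_mulVec_nonneg ?_ fun x => ?_⟩
  · exact (isHermitian_one.smul (IsSelfAdjoint.all _)).sub hA
  · have hle (i j : ι) : x i * (A i j * x j) ≤ |A i j| * (x ⬝ᵥ x) := by
      have hsq (k : ι) : x k * x k ≤ x ⬝ᵥ x :=
        Finset.single_le_sum (f := fun k => x k * x k) (fun k _ => mul_self_nonneg _)
          (Finset.mem_univ k)
      have hxy : |x i * x j| ≤ x ⬝ᵥ x :=
        abs_le.2 ⟨by nlinarith [hsq i, hsq j, sq_nonneg (x i + x j)],
          by nlinarith [hsq i, hsq j, sq_nonneg (x i - x j)]⟩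
      calc x i * (A i j * x j) = A i j * (x i * x j) := by ring
        _ ≤ |A i j * (x i * x j)| := le_abs_self _
        _ = |A i j| * |x i * x j| := abs_mul _ _
        _ ≤ |A i j| * (x ⬝ᵥ x) := by gcongr
    have hsum : x ⬝ᵥ A *ᵥ x ≤ (∑ i, ∑ j, |A i j|) * (x ⬝ᵥ x) := by
      simp only [dotProduct.eq_1 x (A *ᵥ x), mulVec, dotProduct.eq_1 (fun j => A _ j),
        Finset.mul_sum, Finset.sum_mul]
      exact Finset.sum_le_sum fun i _ => Finset.sum_le_sum fun j _ => hle i j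
    simpa [sub_mulVec, smul_mulVec, dotProduct_sub] using hsum

theorem isHermitian_Imat (Φ : Fin 10 → ℝ) : (Imat Φ).IsHermitian := by
  ext i j
  fin_cases i <;> fin_cases j <;> rfl

theorem isHermitian_calZ {N : ℕ} (Θ : Fin N → Fin 10 → ℝ) : (calZ Θ).IsHermitian := by
  rw [IsHermitian, calZ, blockDiagonal_conjTranspose]
  exact congrArg _ (funext fun l => isHermitian_ZMat (Θ l))

/-- The inertial parameters with unit mass, zero first moment and identity inertia matrix. -/
def unitInertia : Fin 10 → ℝ := ![1, 0, 0, 0, 1, 1, 1, 0, 0, 0]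

theorem hVec_unitInertia : hVec unitInertia = 0 := by
  ext i
  fin_cases i <;> rfl

theorem Imat_unitInertia : Imat unitInertia = 1 := by
  ext i j
  fin_cases i <;> fin_cases j <;> simp [Imat, unitInertia]

theorem fMat_unitInertia :
    fMat unitInertia = diagonal (Sum.elim (fun _ => 1 / 2) (fun _ => 1)) := by
  ext (i | i) (j | j)
  · simp [fMat, SigmaMat, Imat_unitInertia, diagonal_apply, one_apply]
    split_ifs <;> norm_num
  · simp [fMat, hVec_unitInertia]
  · simp [fMat, hVec_unitInertia]
  · simp [fMat, unitInertia, Subsingleton.elim i j]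

theorem posDef_fMat_unitInertia : (fMat unitInertia).PosDef := by
  rw [fMat_unitInertia, posDef_diagonal_iff]
  rintro (i | i) <;> norm_num

theorem ZMat_unitInertia : ZMat unitInertia = 1 := by
  have hcross : crossMat 0 = 0 := by
    ext i j
    fin_cases i <;> fin_cases j <;> simp [crossMat]
  have hmass : unitInertia 0 = 1 := rfl
  simp [ZMat, hVec_unitInertia, hcross, Imat_unitInertia, hmass]

theorem calZ_unitInertia {N : ℕ} : calZ (fun _ : Fin N => unitInertia) = 1 := by
  simp only [calZ, ZMat_unitInertia]
  exact blockDiagonal_one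

/-- The Jacobian is uniformly upper bounded iff for every constant physically consistent
set of inertial parameters the mass matrix has a finite upper uniform bound. -/
theorem jacobian_bounded_iff_massMatrix_upper_bound {n N : ℕ} (hn : 1 ≤ n) (hN : 1 ≤ N)
    (J : (Fin n → ℝ) → Matrix ((Fin 3 ⊕ Fin 3) × Fin N) (Fin n) ℝ) :
    (∃ δ : ℝ, 0 ≤ δ ∧
        ∀ q, (δ • (1 : Matrix (Fin n) (Fin n) ℝ) - (J q)ᵀ * J q).PosSemidef) ↔
      ∀ Θ : Fin N → Fin 10 → ℝ, (∀ l, (fMat (Θ l)).PosDef) →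
        ∃ C : ℝ, 0 ≤ C ∧
          ∀ q, (C • (1 : Matrix (Fin n) (Fin n) ℝ) - massMatrix J Θ q).PosSemidef := by
  constructor
  · rintro ⟨δ, hδ, hJ⟩ Θ -
    obtain ⟨c, hc, hZ⟩ := exists_smul_one_sub_posSemidef (isHermitian_calZ Θ)
    refine ⟨c * δ, mul_nonneg hc hδ, fun q => ?_⟩
    have hsplit : (c * δ) • (1 : Matrix (Fin n) (Fin n) ℝ) - massMatrix J Θ q =
        c • (δ • (1 : Matrix (Fin n) (Fin n) ℝ) - (J q)ᵀ * J q) +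
          (J q)ᵀ * (c • 1 - calZ Θ) * J q := by
      simp [massMatrix, smul_sub, mul_smul, Matrix.mul_sub, Matrix.sub_mul]
    rw [hsplit]
    exact ((hJ q).smul hc).add (hZ.conjTranspose_mul_mul_same (J q))
  · intro h
    obtain ⟨C, hC, hM⟩ := h (fun _ => unitInertia) fun _ => posDef_fMat_unitInertia
    refine ⟨C, hC, fun q => ?_⟩
    simpa [massMatrix, calZ_unitInertia] using hM q

end
end

section
/- (Finite upper uniform bound of the mass matrix.) Let n, N ≥ 1, let J : ℝⁿ → ℝ^{(6N)×n}, and let Θ : [0,∞) → ℝ^{10N} with components Φ_l(t) ∈ ℝ^10 for l = 1,…,N. Suppose there is δ ≥ 0 such that δ·I_n − J(q)ᵀJ(q) is positive semidefinite for all q ∈ ℝⁿ, that f(Φ_l(t)) is positive definite for all t ≥ 0 and l ∈ {1,…,N} (physical consistency for all times), and that there is ζ ≥ 0 such that ζ·I₄ − f(Φ_l(t)) is positive definite for all t ≥ 0 and l ∈ {1,…,N} (upper boundedness). Then for all q ∈ ℝⁿ and all t ≥ 0, the matrix M(q,Θ(t)) is positive semidefinite and 2ζδ·I_n − M(q,Θ(t))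 is positive semidefinite. -/
noncomputable section

open Matrix

/-- The linear map sending a twist `(v, w)` to the covector that gives the `k`-th coordinate of the
velocity `v + w × r` when paired with the homogeneous position `(r, 1)`. -/
def twistMat (k : Fin 3) : Matrix (Fin 3 ⊕ Fin 1) (Fin 3 ⊕ Fin 3) ℝ :=
  Matrix.fromBlocks 0 (crossMat (Pi.single k 1)) (Matrix.of fun _ => Pi.single k 1) 0

theorem ZMat_eq_sum_twistMat (Φ : Fin 10 → ℝ) :
    ZMat Φ = ∑ k, (twistMat k)ᵀ * fMat Φ * twistMat k := by
  simp only [ZMat, twistMat, fMat, fromBlocks_transpose, fromBlocks_multiply, Fin.sum_univ_three,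
    fromBlocks_add]
  congr 1 <;> ext i j <;> fin_cases i <;> fin_cases j <;>
    simp [crossMat, hVec, SigmaMat, Imat, trace_fin_three, Matrix.mul_apply,
      Fin.sum_univ_three] <;> ring

theorem sum_twistMat_transpose_mul_self :
    ∑ k, (twistMat k)ᵀ * twistMat k = Matrix.fromBlocks 1 0 0 ((2 : ℝ) • 1) := by
  simp only [twistMat, fromBlocks_transpose, fromBlocks_multiply, Fin.sum_univ_three,
    fromBlocks_add]
  congr 1 <;> ext i j <;> fin_cases i <;> fin_cases j <;>
    simp [crossMat, Matrix.mul_apply, Fin.sum_univ_three] <;> norm_num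

theorem ZMat_posSemidef {Φ : Fin 10 → ℝ} (h : (fMat Φ).PosSemidef) : (ZMat Φ).PosSemidef := by
  rw [ZMat_eq_sum_twistMat]
  exact posSemidef_sum _ fun k _ => h.conjTranspose_mul_mul_same (twistMat k)

theorem two_mul_smul_one_sub_ZMat_posSemidef {Φ : Fin 10 → ℝ} {ζ : ℝ} (hζ : 0 ≤ ζ)
    (h : (ζ • (1 : Matrix (Fin 3 ⊕ Fin 1) (Fin 3 ⊕ Fin 1) ℝ) - fMat Φ).PosSemidef) :
    ((2 * ζ) • (1 : Matrix (Fin 3 ⊕ Fin 3) (Fin 3 ⊕ Fin 3) ℝ) - ZMat Φ).PosSemidef := by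
  have key : (2 * ζ) • (1 : Matrix (Fin 3 ⊕ Fin 3) (Fin 3 ⊕ Fin 3) ℝ) - ZMat Φ =
      ∑ k, (twistMat k)ᵀ * (ζ • 1 - fMat Φ) * twistMat k +
        ζ • diagonal (Sum.elim (fun _ => 1) fun _ => 0) := by
    have hblocks : (2 : ℝ) • (1 : Matrix (Fin 3 ⊕ Fin 3) (Fin 3 ⊕ Fin 3) ℝ) =
        Matrix.fromBlocks 1 0 0 ((2 : ℝ) • 1) +
          diagonal (Sum.elim (fun _ => 1) fun _ => 0) := by
      ext (i | i) (j | j) <;> simp [one_apply, diagonal_apply] <;> split_ifs <;> norm_num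
    simp only [Matrix.mul_sub, Matrix.sub_mul, Finset.sum_sub_distrib, Matrix.mul_smul,
      Matrix.smul_mul, Matrix.mul_one, ← Finset.smul_sum, ← ZMat_eq_sum_twistMat,
      sum_twistMat_transpose_mul_self]
    rw [mul_comm, mul_smul, hblocks, smul_add]
    abel
  rw [key]
  refine (posSemidef_sum _ fun k _ => h.conjTranspose_mul_mul_same (twistMat k)).add
    (PosSemidef.smul (PosSemidef.diagonal ?_) hζ)
  rintro (i | i) <;> simp

theorem posSemidef_blockDiagonal {m o : Type*} [Fintype m] [Fintype o] [DecidableEq o]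
    {A : o → Matrix m m ℝ} (hA : ∀ l, (A l).PosSemidef) : (blockDiagonal A).PosSemidef := by
  refine PosSemidef.of_dotProduct_mulVec_nonneg ?_ fun x => ?_
  · rw [IsHermitian, blockDiagonal_conjTranspose]
    exact congrArg _ (funext fun l => (hA l).isHermitian)
  · have hx : star x ⬝ᵥ blockDiagonal A *ᵥ x =
        ∑ l, star (fun i => x (i, l)) ⬝ᵥ A l *ᵥ fun i => x (i, l) := by
      simp [dotProduct, mulVec, Fintype.sum_prod_type_right, blockDiagonal_apply, ite_mul]
    rw [hx]
    exact Finset.sum_nonneg fun l _ => (hA l).dotProduct_mulVec_nonneg _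

/-- Finite upper uniform bound of the mass matrix: under a uniformly upper bounded
Jacobian and physically consistent, upper bounded inertial parameters,
`0 ⪯ M(q,Θ(t)) ⪯ 2ζδ·I_n`. -/
theorem massMatrix_upper_bound {n N : ℕ} (hn : 1 ≤ n) (hN : 1 ≤ N)
    (J : (Fin n → ℝ) → Matrix ((Fin 3 ⊕ Fin 3) × Fin N) (Fin n) ℝ)
    (Θ : ℝ → Fin N → Fin 10 → ℝ)
    (δ : ℝ) (hδ : 0 ≤ δ)
    (hJ : ∀ q, (δ • (1 : Matrix (Fin n) (Fin n) ℝ) - (J q)ᵀ * J q).PosSemidef)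
    (hcons : ∀ t, 0 ≤ t → ∀ l, (fMat (Θ t l)).PosDef)
    (ζ : ℝ) (hζ : 0 ≤ ζ)
    (hub : ∀ t, 0 ≤ t → ∀ l,
      (ζ • (1 : Matrix (Fin 3 ⊕ Fin 1) (Fin 3 ⊕ Fin 1) ℝ) - fMat (Θ t l)).PosDef) :
    ∀ (q : Fin n → ℝ) (t : ℝ), 0 ≤ t →
      (massMatrix J (Θ t) q).PosSemidef ∧
        ((2 * ζ * δ) • (1 : Matrix (Fin n) (Fin n) ℝ) - massMatrix J (Θ t) q).PosSemidef := by
  intro q t ht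
  constructor
  · exact (posSemidef_blockDiagonal fun l =>
      ZMat_posSemidef (hcons t ht l).posSemidef).conjTranspose_mul_mul_same (J q)
  · have hZ : ((2 * ζ) • 1 - calZ (Θ t)).PosSemidef := by
      rw [calZ, ← blockDiagonal_one, ← blockDiagonal_smul, ← blockDiagonal_sub]
      exact posSemidef_blockDiagonal fun l =>
        two_mul_smul_one_sub_ZMat_posSemidef hζ (hub t ht l).posSemidef
    have key : (2 * ζ * δ) • (1 : Matrix (Fin n) (Fin n) ℝ) - massMatrix J (Θ t) q =
        (J q)ᵀ * ((2 * ζ) • 1 - calZ (Θ t)) * J q +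
          (2 * ζ) • (δ • (1 : Matrix (Fin n) (Fin n) ℝ) - (J q)ᵀ * J q) := by
      simp only [massMatrix, Matrix.mul_sub, Matrix.sub_mul, Matrix.mul_smul, Matrix.smul_mul,
        Matrix.mul_one, smul_sub, smul_smul]
      abel
    rw [key]
    exact (hZ.conjTranspose_mul_mul_same (J q)).add ((hJ q).smul (by positivity))

end
end

section
/- For every x ∈ ℝ³ and every R ∈ ℝ^{3×3}, one has 𝒮(x)·R = −S·𝒜₃,₃(R)·T·𝒜₃,₁(x), where 𝒜₃,₃(R) = blockdiag(R,R,R) ∈ ℝ^{9×9} and 𝒜₃,₁(x) = blockdiag(x,x,x) ∈ ℝ^{9×3}. -/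
noncomputable section

open Matrix

/-- The 3×9 matrix `S` with `𝒮(y) = S·𝒜₃,₁(y)`. -/
def Smat : Matrix (Fin 3) (Fin 9) ℝ :=
  !![0, 0, 0, 0, 0, -1, 0, 1, 0;
     0, 0, 1, 0, 0, 0, -1, 0, 0;
     0, -1, 0, 1, 0, 0, 0, 0, 0]

/-- The 9×9 permutation matrix `T`. -/
def Tmat : Matrix (Fin 9) (Fin 9) ℝ :=
  !![1, 0, 0, 0, 0, 0, 0, 0, 0;
     0, 0, 0, 1, 0, 0, 0, 0, 0;
     0, 0, 0, 0, 0, 0, 1, 0, 0;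
     0, 1, 0, 0, 0, 0, 0, 0, 0;
     0, 0, 0, 0, 1, 0, 0, 0, 0;
     0, 0, 0, 0, 0, 0, 0, 1, 0;
     0, 0, 1, 0, 0, 0, 0, 0, 0;
     0, 0, 0, 0, 0, 1, 0, 0, 0;
     0, 0, 0, 0, 0, 0, 0, 0, 1]

/-- `𝒜₃,₃(R) = blockdiag(R,R,R) ∈ ℝ^{9×9}`. -/
def A33 (R : Matrix (Fin 3) (Fin 3) ℝ) : Matrix (Fin 9) (Fin 9) ℝ :=
  Matrix.of fun i j =>
    if (i : ℕ) / 3 = (j : ℕ) / 3 then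
      R ⟨(i : ℕ) % 3, Nat.mod_lt _ (by norm_num)⟩ ⟨(j : ℕ) % 3, Nat.mod_lt _ (by norm_num)⟩
    else 0

/-- `𝒜₃,₁(x) = blockdiag(x,x,x) ∈ ℝ^{9×3}`. -/
def A31 (x : Fin 3 → ℝ) : Matrix (Fin 9) (Fin 3) ℝ :=
  Matrix.of fun i j =>
    if (i : ℕ) / 3 = (j : ℕ) then x ⟨(i : ℕ) % 3, Nat.mod_lt _ (by norm_num)⟩ else 0

/-- `T·𝒜₃,₁(x) = x ⊗ I₃`. -/
lemma Tmat_mul_A31 (x : Fin 3 → ℝ) :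
    Tmat * A31 x = of fun i j =>
      if Fin.modNat (m := 3) (n := 3) i = j then x (Fin.divNat (m := 3) (n := 3) i) else 0 := by
  ext i j
  fin_cases i <;> fin_cases j <;>
    simp [Matrix.mul_apply, Fin.sum_univ_succ, Tmat, A31, Fin.modNat, Fin.divNat]

/-- `𝒜₃,₃(R)·(x ⊗ I₃) = x ⊗ R`. -/
lemma A33_mul_Tmat_mul_A31 (x : Fin 3 → ℝ) (R : Matrix (Fin 3) (Fin 3) ℝ) :
    A33 R * (Tmat * A31 x) = of fun i j =>
      x (Fin.divNat (m := 3) (n := 3) i) * R (Fin.modNat (m := 3) (n := 3) i) j := by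
  rw [Tmat_mul_A31]
  ext i j
  rw [Matrix.mul_apply, Finset.sum_eq_single (⟨3 * (i / 3) + j, by lia⟩ : Fin 9)]
  · have hdiv : (3 * ((i : ℕ) / 3) + j) / 3 = i / 3 := by lia
    have hmod : (3 * ((i : ℕ) / 3) + j) % 3 = j := by lia
    simp [A33, Fin.modNat, Fin.divNat, hdiv, hmod]
    exact mul_comm _ _
  · intro k _ hk
    have hne : (i : ℕ) / 3 = k / 3 → (k : ℕ) % 3 ≠ j := by
      intro h h'
      exact hk (Fin.ext (by simp only; lia))
    by_cases h : (i : ℕ) / 3 = k / 3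
    · simp [Fin.modNat, Fin.ext_iff, hne h]
    · simp [A33, h]
  · simp

/-- `𝒮(x)·R = −S·𝒜₃,₃(R)·T·𝒜₃,₁(x)` for all `x ∈ ℝ³`, `R ∈ ℝ^{3×3}`. -/
theorem crossMat_mul_eq (x : Fin 3 → ℝ) (R : Matrix (Fin 3) (Fin 3) ℝ) :
    crossMat x * R = -(Smat * A33 R * Tmat * A31 x) := by
  rw [Matrix.mul_assoc, Matrix.mul_assoc, A33_mul_Tmat_mul_A31]
  ext i j
  fin_cases i <;>
    simp [Matrix.mul_apply, Fin.sum_univ_succ, crossMat, Smat, Fin.modNat, Fin.divNat,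
      vecHead, vecTail]

end
end

section
/- (Skew symmetry along a trajectory.) Let n ≥ 1 and let M : ℝⁿ × ℝ^p → ℝ^{n×n} be such that M(q,Θ) is symmetric for all (q,Θ), each entry is differentiable in q, and M is linear in the second argument Θ (i.e., M(q,·) : ℝ^p → ℝ^{n×n} is linear for each q). Define Γ_{i,j,k}(q,Θ) = (1/2)·(∂M_{k,j}/∂q_i + ∂M_{k,i}/∂q_j − ∂M_{i,j}/∂q_k)(q,Θ) and C(q,v,Θ)_{k,j} = Σ_{i=1}^n Γ_{i,j,k}(q,Θ)·v_i. Let q : ℝ → ℝⁿ and Θ : ℝ → ℝ^p be differentiable. Then for every t, the matrix (d/dt)[M(q(t),Θ(t))] − 2·C(q(t), q̇(t), Θ(t)) − M(q(t), Θ̇(t)) is skew-symmetric. -/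
noncomputable section

open Matrix

/-- Partial derivative of `g : ℝⁿ → ℝ` in the `i`-th coordinate direction. -/
def pderiv' {n : ℕ} (g : (Fin n → ℝ) → ℝ) (i : Fin n) (q : Fin n → ℝ) : ℝ :=
  fderiv ℝ g q (Pi.single i 1)

/-- Christoffel symbols of the first kind for a parameter-dependent mass matrix. -/
def christoffel {n p : ℕ}
    (M : (Fin n → ℝ) → (Fin p → ℝ) → Matrix (Fin n) (Fin n) ℝ)
    (i j k : Fin n) (q : Fin n → ℝ) (Θ : Fin p → ℝ) : ℝ :=
  (1 / 2 : ℝ) * (pderiv' (fun q' => M q' Θ k j) i q + pderiv' (fun q' => M q' Θ k i) j q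
    - pderiv' (fun q' => M q' Θ i j) k q)

/-- The Coriolis matrix `C(q,v,Θ)_{k,j} = Σ_i Γ_{i,j,k}(q,Θ)·v_i`. -/
def coriolis {n p : ℕ}
    (M : (Fin n → ℝ) → (Fin p → ℝ) → Matrix (Fin n) (Fin n) ℝ)
    (q v : Fin n → ℝ) (Θ : Fin p → ℝ) : Matrix (Fin n) (Fin n) ℝ :=
  Matrix.of fun k j => ∑ i, christoffel M i j k q Θ * v i

/-- The directional derivative of a function on `ℝⁿ` in terms of its partial derivatives. -/
lemma fderiv_apply_eq_sum_pderiv' {n : ℕ} (g : (Fin n → ℝ) → ℝ) (q v : Fin n → ℝ) :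
    fderiv ℝ g q v = ∑ i, pderiv' g i q * v i := by
  conv_lhs => rw [pi_eq_sum_univ' v, map_sum]
  refine Finset.sum_congr rfl fun i _ => ?_
  rw [map_smul, smul_eq_mul, mul_comm, pderiv']

/-- A linear map into matrices, expanded entrywise in the standard basis. -/
lemma IsLinearMap.matrix_apply_eq_sum {m n p : ℕ}
    {L : (Fin p → ℝ) → Matrix (Fin m) (Fin n) ℝ} (hL : IsLinearMap ℝ L)
    (θ : Fin p → ℝ) (k : Fin m) (j : Fin n) :
    L θ k j = ∑ a, θ a * L (Pi.single a 1) k j := by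
  have h := LinearMap.pi_apply_eq_sum_univ (hL.mk' L) θ
  simp only [IsLinearMap.mk'_apply] at h
  rw [h, Matrix.sum_apply]
  refine Finset.sum_congr rfl fun a _ => ?_
  rw [Matrix.smul_apply, smul_eq_mul]
  congr 3
  ext b
  simp [Pi.single_apply, eq_comm]

/-- The chain rule for the entries of a matrix function that is differentiable in its first
argument and linear in its second. -/
lemma deriv_entry_along_trajectory {n p : ℕ}
    {M : (Fin n → ℝ) → (Fin p → ℝ) → Matrix (Fin n) (Fin n) ℝ}
    (hdiff : ∀ (Θ : Fin p → ℝ) (k j : Fin n), Differentiable ℝ fun q => M q Θ k j)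
    (hlin : ∀ q : Fin n → ℝ, IsLinearMap ℝ (M q))
    {q : ℝ → Fin n → ℝ} {Θ : ℝ → Fin p → ℝ} {t : ℝ}
    (hq : DifferentiableAt ℝ q t) (hΘ : DifferentiableAt ℝ Θ t) (k j : Fin n) :
    deriv (fun s => M (q s) (Θ s) k j) t =
      M (q t) (deriv Θ t) k j + ∑ i, pderiv' (fun x => M x (Θ t) k j) i (q t) * deriv q t i := by
  have hM : ∀ a, HasDerivAt (fun s => M (q s) (Pi.single a 1) k j)
      (fderiv ℝ (fun x => M x (Pi.single a 1) k j) (q t) (deriv q t)) t := fun a =>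
    ((hdiff (Pi.single a 1) k j (q t)).hasFDerivAt).comp_hasDerivAt t hq.hasDerivAt
  have hθ : ∀ a, HasDerivAt (fun s => Θ s a) (deriv Θ t a) t := hasDerivAt_pi.1 hΘ.hasDerivAt
  have hsum := HasDerivAt.fun_sum fun a (_ : a ∈ Finset.univ) => (hθ a).mul (hM a)
  have hpartial : HasFDerivAt (fun x => M x (Θ t) k j)
      (∑ a, Θ t a • fderiv ℝ (fun x => M x (Pi.single a 1) k j) (q t)) (q t) := by
    simp only [fun x => (hlin x).matrix_apply_eq_sum (Θ t) k j]
    exact HasFDerivAt.fun_sum fun a _ =>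
      ((hdiff (Pi.single a 1) k j (q t)).hasFDerivAt).const_mul (Θ t a)
  rw [← fderiv_apply_eq_sum_pderiv', hpartial.fderiv,
    (hlin (q t)).matrix_apply_eq_sum (deriv Θ t) k j]
  simp only [fun s => (hlin (q s)).matrix_apply_eq_sum (Θ s) k j]
  refine hsum.deriv.trans ?_
  simp [Finset.sum_add_distrib]

/-- Skew symmetry along a trajectory:
`d/dt[M(q(t),Θ(t))] − 2C(q(t),q̇(t),Θ(t)) − M(q(t),Θ̇(t))` is skew-symmetric. -/
theorem skew_symmetry_along_trajectory {n p : ℕ} (hn : 1 ≤ n)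
    (M : (Fin n → ℝ) → (Fin p → ℝ) → Matrix (Fin n) (Fin n) ℝ)
    (hsymm : ∀ q Θ, (M q Θ).IsSymm)
    (hdiff : ∀ (Θ : Fin p → ℝ) (k j : Fin n), Differentiable ℝ fun q => M q Θ k j)
    (hlin : ∀ q : Fin n → ℝ, IsLinearMap ℝ (M q))
    (q : ℝ → Fin n → ℝ) (Θ : ℝ → Fin p → ℝ)
    (hq : Differentiable ℝ q) (hΘ : Differentiable ℝ Θ) :
    ∀ t : ℝ,
      (Matrix.of (fun k j => deriv (fun s => M (q s) (Θ s) k j) t)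
          - (2 : ℝ) • coriolis M (q t) (deriv q t) (Θ t)
          - M (q t) (deriv Θ t))
        = -(Matrix.of (fun k j => deriv (fun s => M (q s) (Θ s) k j) t)
          - (2 : ℝ) • coriolis M (q t) (deriv q t) (Θ t)
          - M (q t) (deriv Θ t))ᵀ := by
  intro t
  have hswap : ∀ a b : Fin n, (fun x => M x (Θ t) a b) = fun x => M x (Θ t) b a := fun a b =>
    funext fun x => (hsymm x (Θ t)).apply b a
  ext k j
  simp only [Matrix.neg_apply, Matrix.transpose_apply, Matrix.sub_apply, Matrix.smul_apply,
    Matrix.of_apply, coriolis, christoffel, smul_eq_mul,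
    deriv_entry_along_trajectory hdiff hlin (hq t) (hΘ t), Finset.mul_sum]
  rw [← sub_eq_zero, sub_neg_eq_add]
  have hsum : ∀ a b c d : Fin n → ℝ, (∀ i, a i - b i + (c i - d i) = 0) →
      ∀ x y : ℝ, x + ∑ i, a i - ∑ i, b i - x + (y + ∑ i, c i - ∑ i, d i - y) = 0 := by
    intro a b c d h x y
    have := Finset.sum_eq_zero fun i (_ : i ∈ Finset.univ) => h i
    simp only [Finset.sum_add_distrib, Finset.sum_sub_distrib] at this
    linarith
  refine hsum _ _ _ _ (fun i => ?_) _ _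
  rw [hswap j k, hswap i j, hswap i k]
  ring

end
end
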